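/- Let H be the 6-vertex cycle whose six edges are coloured alternately blue and red as one goes along the cycle. Then the semi-inducibility constant λ_H equals 1/2^6 = 1/64. -/

import Mathlib

open Finset
open scoped Classical

/-- Number of embeddings into `G` of the 6-cycle with edges `{i, i+1}` (indices mod 6),
where the edge `{i, i+1}` is red (must map to an edge) when `i` is odd and blue (must map
to a non-edge) when `i` is even: an injection realising these adjacency constraints. -/
noncomputable def numEmbAltC6 {n : ℕ} (G : SimpleGraph (Fin n)) : ℕ :=
  (Finset.univ.filter (fun f : Fin 6 → Fin n =>
    Function.Injective f ∧
    (∀ i : Fin 6, i.val % 2 = 1 → G.Adj (f i) (f (i + 1))) ∧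
    (∀ i : Fin 6, i.val % 2 = 0 → ¬ G.Adj (f i) (f (i + 1))))).card

/-- `λ_H(G)` for the alternating 6-cycle `H`: embedding count divided by `n(n−1)⋯(n−5)`. -/
noncomputable def lamAltC6 {n : ℕ} (G : SimpleGraph (Fin n)) : ℝ :=
  (numEmbAltC6 G : ℝ) / (n.descFactorial 6 : ℝ)

/-- `λ_H(n)`: the maximum of `λ_H(G)` over all graphs on `n` vertices. -/
noncomputable def lamAltC6max (n : ℕ) : ℝ :=
  ⨆ G : SimpleGraph (Fin n), lamAltC6 G

section AltC6

lemma altC6_moments {n : ℕ} (w t : Fin n → ℝ) (a0 a1 a2 a3 : ℝ) :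
    ∑ i, w i * (a0 + a1 * t i + a2 * t i ^ 2 + a3 * t i ^ 3) =
      a0 * ∑ i, w i + a1 * ∑ i, w i * t i + a2 * ∑ i, w i * t i ^ 2
        + a3 * ∑ i, w i * t i ^ 3 := by
  simp only [Finset.mul_sum, ← Finset.sum_add_distrib]
  exact Finset.sum_congr rfl fun i _ => by ring

/-- the main pair inequality `m₂ m₄ - m₃² ≤ m₂ - m₄` -/
lemma altC6_pair {n : ℕ} (w t : Fin n → ℝ) (hw : ∀ i, 0 ≤ w i) (hw1 : ∑ i, w i = 1)
    (ht : ∑ i, t i ^ 2 ≤ 1) :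
    (∑ i, w i * t i ^ 2) * (∑ i, w i * t i ^ 4) - (∑ i, w i * t i ^ 3) ^ 2
      ≤ (∑ i, w i * t i ^ 2) - ∑ i, w i * t i ^ 4 := by
  have key : 0 ≤ ∑ i, ∑ j, ((w i + w j) / 2 * (t i ^ 2 * t j ^ 2)
      - (if i = j then w i * t i ^ 4 else 0)
      - w i * w j * (t i ^ 2 * t j ^ 2) * (t i - t j) ^ 2 / 2) := by
    refine Finset.sum_nonneg fun i _ => Finset.sum_nonneg fun j _ => ?_
    by_cases h : i = j
    · subst h
      simp only [if_true]
      apply le_of_eq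
      ring
    · rw [if_neg h]
      have h1 : t i ^ 2 + t j ^ 2 ≤ 1 := by
        rw [← Finset.sum_pair (f := fun k => t k ^ 2) h]
        exact (Finset.sum_le_univ_sum_of_nonneg (fun k => sq_nonneg (t k))).trans ht
      have h2 : w i + w j ≤ 1 := by
        rw [← Finset.sum_pair (f := w) h, ← hw1]
        exact Finset.sum_le_univ_sum_of_nonneg hw
      have h3 : (t i - t j) ^ 2 ≤ 2 := by nlinarith [sq_nonneg (t i + t j)]
      have h4 : w i * w j * (t i - t j) ^ 2 ≤ w i * w j * 2 :=
        mul_le_mul_of_nonneg_left h3 (mul_nonneg (hw i) (hw j))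
      have h5 : w i * w j * 2 ≤ w i + w j := by
        nlinarith [hw i, hw j, sq_nonneg (w i - w j)]
      have h6 : 0 ≤ t i ^ 2 * t j ^ 2 := by positivity
      nlinarith [mul_nonneg h6 (sub_nonneg.2 (h4.trans h5))]
  have e1 : ∑ i, ∑ j, ((w i + w j) / 2 * (t i ^ 2 * t j ^ 2)
      - (if i = j then w i * t i ^ 4 else 0)
      - w i * w j * (t i ^ 2 * t j ^ 2) * (t i - t j) ^ 2 / 2)
      = (∑ i, w i * t i ^ 2) * (∑ i, t i ^ 2) - ∑ i, w i * t i ^ 4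
        - ((∑ i, w i * t i ^ 2) * (∑ i, w i * t i ^ 4) - (∑ i, w i * t i ^ 3) ^ 2) := by
    have : ∀ i, ∑ j, ((w i + w j) / 2 * (t i ^ 2 * t j ^ 2)
      - (if i = j then w i * t i ^ 4 else 0)
      - w i * w j * (t i ^ 2 * t j ^ 2) * (t i - t j) ^ 2 / 2)
      = (w i * t i ^ 2) * ((∑ j, t j ^ 2) / 2) + t i ^ 2 * ((∑ j, w j * t j ^ 2) / 2)
        - w i * t i ^ 4 - (w i * t i ^ 4) * ((∑ j, w j * t j ^ 2) / 2)
        - (w i * t i ^ 2) * ((∑ j, w j * t j ^ 4) / 2) + (w i * t i ^ 3) * (∑ j, w j * t j ^ 3) := by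
      intro i
      rw [Finset.sum_sub_distrib, Finset.sum_sub_distrib, Finset.sum_ite_eq]
      simp only [Finset.mem_univ, if_true]
      have : ∀ S1 S2 R1 R2 X : ℝ, S1 = R1 → S2 = R2 → S1 - X - S2 = R1 - X - R2 := by
        intros; subst_vars; rfl
      rw [this _ _ ((w i * t i ^ 2) * ((∑ j, t j ^ 2) / 2) + t i ^ 2 * ((∑ j, w j * t j ^ 2) / 2))
        ((w i * t i ^ 4) * ((∑ j, w j * t j ^ 2) / 2)
        + (w i * t i ^ 2) * ((∑ j, w j * t j ^ 4) / 2) - (w i * t i ^ 3) * (∑ j, w j * t j ^ 3))]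
      · ring
      · simp only [Finset.mul_sum, Finset.sum_div, ← Finset.sum_add_distrib]
        exact Finset.sum_congr rfl fun j _ => by ring
      · simp only [Finset.mul_sum, Finset.sum_div, ← Finset.sum_add_distrib,
          ← Finset.sum_sub_distrib]
        exact Finset.sum_congr rfl fun j _ => by ring
    simp only [this, Finset.sum_add_distrib, Finset.sum_sub_distrib, ← Finset.sum_mul]
    ring
  rw [e1] at key
  have h2 : 0 ≤ ∑ i, w i * t i ^ 2 :=
    Finset.sum_nonneg fun i _ => mul_nonneg (hw i) (sq_nonneg _)
  nlinarith

lemma altC6_real {n : ℕ} (w t : Fin n → ℝ) (hw : ∀ i, 0 ≤ w i) (hw1 : ∑ i, w i = 1)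
    (ht : ∑ i, t i ^ 2 ≤ 1) (d s m3 m4 : ℝ) (hd : ∑ i, w i * t i = d)
    (hs : ∑ i, w i * t i ^ 2 = s) (h3 : ∑ i, w i * t i ^ 3 = m3)
    (h4 : ∑ i, w i * t i ^ 4 = m4) :
    3 * d ^ 2 - 6 * s + 3 * s ^ 2 - 6 * d * m3 + 6 * m4 ≤ 0 := by
  have hp := altC6_pair w t hw hw1 ht
  have hy : ∀ i, 0 ≤ 1 - t i ^ 2 := fun i => by
    have := (Finset.single_le_sum (f := fun k => t k ^ 2) (fun k _ => sq_nonneg (t k))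
      (Finset.mem_univ i)).trans ht
    linarith
  have cs := Finset.sum_sq_le_sum_mul_sum_of_sq_le_mul Finset.univ
    (r := fun i => w i * t i * (1 - t i ^ 2)) (f := fun i => w i * t i ^ 2 * (1 - t i ^ 2))
    (g := fun i => w i * (1 - t i ^ 2))
    (fun i _ => mul_nonneg (mul_nonneg (hw i) (sq_nonneg _)) (hy i))
    (fun i _ => mul_nonneg (hw i) (hy i)) (fun i _ => le_of_eq (by ring))
  have a1 : ∑ i, w i * t i * (1 - t i ^ 2) = d - m3 := by
    rw [← hd, ← h3, ← Finset.sum_sub_distrib]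
    exact Finset.sum_congr rfl fun j _ => by ring
  have a2 : ∑ i, w i * t i ^ 2 * (1 - t i ^ 2) = s - m4 := by
    rw [← hs, ← h4, ← Finset.sum_sub_distrib]
    exact Finset.sum_congr rfl fun j _ => by ring
  have a3 : ∑ i, w i * (1 - t i ^ 2) = 1 - s := by
    rw [← hs]
    conv_rhs => rw [← hw1]
    rw [← Finset.sum_sub_distrib]
    exact Finset.sum_congr rfl fun j _ => by ring
  rw [a1, a2, a3] at cs
  rw [hs, h3, h4] at hp
  nlinarith

open Matrix in
lemma altC6_diag {n : ℕ} (u t : Fin n → ℝ) (hu : ∑ i, u i ^ 2 = 1) (ht : ∑ i, t i ^ 2 ≤ 1) :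
    (((vecMulVec u u - diagonal t) * (vecMulVec u u + diagonal t)) *
      ((vecMulVec u u - diagonal t) * (vecMulVec u u + diagonal t)) *
      ((vecMulVec u u - diagonal t) * (vecMulVec u u + diagonal t))).trace ≤ 1 := by
  set X : Matrix (Fin n) (Fin n) ℝ := Matrix.of fun i j => u i * u j * (1 + t j - t i) with hX
  set D : Matrix (Fin n) (Fin n) ℝ := diagonal (fun i => t i ^ 2) with hD
  have hK : (vecMulVec u u - diagonal t) * (vecMulVec u u + diagonal t) = X - D := by
    have e : vecMulVec u u * vecMulVec u u = vecMulVec u u := by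
      ext i j
      simp only [mul_apply, vecMulVec_apply]
      have : ∀ k, u i * u k * (u k * u j) = u i * u j * u k ^ 2 := fun k => by ring
      simp only [this, ← Finset.mul_sum, hu, mul_one]
    have : (vecMulVec u u - diagonal t) * (vecMulVec u u + diagonal t)
      = vecMulVec u u * vecMulVec u u + vecMulVec u u * diagonal t
        - diagonal t * vecMulVec u u - diagonal t * diagonal t := by noncomm_ring
    rw [this, e, hX, hD, diagonal_mul_diagonal]
    ext i j
    simp only [Matrix.sub_apply, Matrix.add_apply, mul_diagonal, diagonal_mul, vecMulVec_apply, of_apply,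
      diagonal_apply, pow_two]
    ring
  rw [hK]
  have hexp : ((X - D) * (X - D) * (X - D)).trace
      = (X * X * X).trace - 3 * (X * X * D).trace + 3 * (X * (D * D)).trace
        - (D * D * D).trace := by
    have : (X - D) * (X - D) * (X - D) = X * X * X - X * X * D - X * D * X - D * X * X
        + X * D * D + D * X * D + D * D * X - D * D * D := by noncomm_ring
    rw [this]
    simp only [trace_add, trace_sub]
    have c1 : (X * D * X).trace = (X * X * D).trace := by rw [trace_mul_comm, mul_assoc]
    have c2 : (D * X * X).trace = (X * X * D).trace := by rw [mul_assoc, trace_mul_comm]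
    have c3 : (D * X * D).trace = (X * (D * D)).trace := by
      rw [mul_assoc, trace_mul_comm, mul_assoc]
    have c4 : (D * D * X).trace = (X * (D * D)).trace := by rw [trace_mul_comm]
    rw [c1, c2, c3, c4, mul_assoc X D D]
    ring
  obtain ⟨w, hwd⟩ : ∃ w : Fin n → ℝ, w = fun i => u i ^ 2 := ⟨_, rfl⟩
  have hw : ∀ i, 0 ≤ w i := fun i => by rw [hwd]; positivity
  have hw1 : ∑ i, w i = 1 := by rw [hwd]; exact hu
  obtain ⟨d, hd⟩ : ∃ d, ∑ i, w i * t i = d := ⟨_, rfl⟩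
  obtain ⟨s, hs⟩ : ∃ d, ∑ i, w i * t i ^ 2 = d := ⟨_, rfl⟩
  obtain ⟨m3, h3⟩ : ∃ d, ∑ i, w i * t i ^ 3 = d := ⟨_, rfl⟩
  obtain ⟨m4, h4⟩ : ∃ d, ∑ i, w i * t i ^ 4 = d := ⟨_, rfl⟩
  have main := altC6_real w t hw hw1 ht d s m3 m4 hd hs h3 h4
  have M : ∀ a0 a1 a2 a3 : ℝ, ∑ i, w i * (a0 + a1 * t i + a2 * t i ^ 2 + a3 * t i ^ 3)
      = a0 + a1 * d + a2 * s + a3 * m3 := by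
    intro a0 a1 a2 a3
    rw [altC6_moments, hw1, hd, hs, h3, mul_one]
  have t1 : (X * X * X).trace = 1 - 3 * (s - d ^ 2) := by
    have : (X * X * X).trace = ∑ i, w i * ∑ k, w k * ((1 + t i - t k) *
        ∑ j, w j * ((1 + t j - t i) * (1 + t k - t j))) := by
      simp only [trace, diag_apply, mul_apply, hX, of_apply, Finset.sum_mul, Finset.mul_sum, hwd]
      refine Finset.sum_congr rfl fun i _ => Finset.sum_congr rfl fun k _ =>
        Finset.sum_congr rfl fun j _ => by ring
    rw [this]
    have q1 : ∀ i k, ∑ j, w j * ((1 + t j - t i) * (1 + t k - t j))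
        = (1 - t i) * (1 + t k) + (t i + t k) * d - s := by
      intro i k
      have := M ((1 - t i) * (1 + t k)) (t i + t k) (-1) 0
      rw [← sub_eq_zero] at this ⊢
      rw [← this]
      have : ∑ j, w j * ((1 + t j - t i) * (1 + t k - t j)) = ∑ j, w j * ((1 - t i) * (1 + t k)
        + (t i + t k) * t j + (-1) * t j ^ 2 + 0 * t j ^ 3) :=
        Finset.sum_congr rfl fun j _ => by ring
      rw [this]; ring
    simp only [q1]
    have q2 : ∀ i, ∑ k, w k * ((1 + t i - t k) * ((1 - t i) * (1 + t k) + (t i + t k) * d - s))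
        = (1 + t i) * (1 - t i + t i * d - s) + ((1 + t i) * (1 - t i + d) - (1 - t i + t i * d - s)) * d
          - (1 - t i + d) * s := by
      intro i
      have := M ((1 + t i) * (1 - t i + t i * d - s))
        ((1 + t i) * (1 - t i + d) - (1 - t i + t i * d - s)) (-(1 - t i + d)) 0
      rw [show (1 + t i) * (1 - t i + t i * d - s) + ((1 + t i) * (1 - t i + d) - (1 - t i + t i * d - s)) * d
          - (1 - t i + d) * s = (1 + t i) * (1 - t i + t i * d - s) + ((1 + t i) * (1 - t i + d) - (1 - t i + t i * d - s)) * d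
          + (-(1 - t i + d)) * s + 0 * m3 by ring, ← this]
      exact Finset.sum_congr rfl fun j _ => by ring
    simp only [q2]
    have := M (1 - s + d * (1 + d) - d * (1 - s) - (1 + d) * s)
      ((d - 1) + (1 - s) + d * (-1 + (1 + d)) - d * (d - 1) + s) ((d - 1) - d) 0
    rw [show 1 - 3 * (s - d ^ 2) = (1 - s + d * (1 + d) - d * (1 - s) - (1 + d) * s) +
      ((d - 1) + (1 - s) + d * (-1 + (1 + d)) - d * (d - 1) + s) * d + ((d - 1) - d) * s
      + 0 * m3 by ring, ← this]
    exact Finset.sum_congr rfl fun j _ => by ring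
  have t2 : (X * X * D).trace = s - s ^ 2 + 2 * d * m3 - m4 := by
    have : (X * X * D).trace = ∑ i, w i * t i ^ 2 *
        ∑ j, w j * ((1 + t j - t i) * (1 + t i - t j)) := by
      simp only [trace, diag_apply, hD, mul_diagonal]
      simp only [mul_apply, hX, of_apply, Finset.sum_mul,
        Finset.mul_sum, hwd]
      refine Finset.sum_congr rfl fun i _ => Finset.sum_congr rfl fun k _ => by ring
    rw [this]
    have q1 : ∀ i, ∑ j, w j * ((1 + t j - t i) * (1 + t i - t j))
        = (1 - t i ^ 2) + 2 * t i * d + (-1) * s + 0 * m3 := by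
      intro i
      rw [← M]
      exact Finset.sum_congr rfl fun j _ => by ring
    simp only [q1]
    rw [show s - s ^ 2 + 2 * d * m3 - m4 = s * (1 - s) + m3 * (2 * d) - m4 by ring]
    conv_rhs => rw [← h4]
    conv_rhs => enter [1, 1, 1]; rw [← hs]
    conv_rhs => enter [1, 2, 1]; rw [← h3]
    simp only [Finset.sum_mul, ← Finset.sum_add_distrib, ← Finset.sum_sub_distrib]
    exact Finset.sum_congr rfl fun j _ => by ring
  have t3 : (X * (D * D)).trace = m4 := by
    rw [hD, diagonal_mul_diagonal, ← h4]
    simp only [trace, diag_apply, mul_diagonal, hX, of_apply, hwd]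
    exact Finset.sum_congr rfl fun j _ => by ring
  have t4 : 0 ≤ (D * D * D).trace := by
    rw [hD, diagonal_mul_diagonal, diagonal_mul_diagonal, trace_diagonal]
    exact Finset.sum_nonneg fun i _ => by positivity
  rw [hexp, t1, t2, t3]
  nlinarith

open Matrix in
lemma altC6_matrix {n : ℕ} (e : Fin n → ℝ) (M : Matrix (Fin n) (Fin n) ℝ) (hM : M.IsHermitian)
    (he : ∑ i, e i ^ 2 = 1) (hM2 : (M * M).trace ≤ 1) :
    (((vecMulVec e e - M) * (vecMulVec e e + M)) *
      ((vecMulVec e e - M) * (vecMulVec e e + M)) *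
      ((vecMulVec e e - M) * (vecMulVec e e + M))).trace ≤ 1 := by
  obtain ⟨U, V, t, hUV, hVU, hV, hMt⟩ : ∃ (U V : Matrix (Fin n) (Fin n) ℝ) (t : Fin n → ℝ),
      U * V = 1 ∧ V * U = 1 ∧ V = Uᵀ ∧ M = U * diagonal t * V := by
    refine ⟨hM.eigenvectorUnitary, star (hM.eigenvectorUnitary : Matrix (Fin n) (Fin n) ℝ),
      hM.eigenvalues, ?_, ?_, ?_, ?_⟩
    · exact Unitary.mul_star_self_of_mem hM.eigenvectorUnitary.2
    · exact Unitary.star_mul_self_of_mem hM.eigenvectorUnitary.2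
    · ext i j; simp [star_apply]
    · have := hM.spectral_theorem
      simpa [Unitary.conjStarAlgAut_apply, Function.comp_def] using this
  set u : Fin n → ℝ := V *ᵥ e with hu
  have hP : vecMulVec e e = U * vecMulVec u u * V := by
    have h1 : U *ᵥ u = e := by rw [hu, mulVec_mulVec, hUV, one_mulVec]
    have h2 : u ᵥ* V = e := by rw [hV, vecMul_transpose, h1]
    rw [mul_vecMulVec, vecMulVec_mul, h1, h2]
  have hu1 : ∑ i, u i ^ 2 = 1 := by
    have h0 : (vecMulVec e e).trace = (vecMulVec u u).trace := by
      rw [hP, trace_mul_comm, ← mul_assoc, hVU, one_mul]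
    rw [← he]
    simp only [trace, diag_apply, vecMulVec_apply] at h0
    simp only [pow_two]
    exact h0.symm
  have ht : ∑ i, t i ^ 2 ≤ 1 := by
    have h0 : (M * M).trace = (diagonal t * diagonal t).trace := by
      have : M * M = U * (diagonal t * (V * U) * diagonal t) * V := by
        rw [hMt]; noncomm_ring
      rw [this, hVU, mul_one, trace_mul_comm, ← mul_assoc, hVU, one_mul]
    rw [h0, diagonal_mul_diagonal, trace_diagonal] at hM2
    simpa only [pow_two] using hM2
  have main := altC6_diag u t hu1 ht
  have hK : (vecMulVec e e - M) * (vecMulVec e e + M)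
      = U * ((vecMulVec u u - diagonal t) * (vecMulVec u u + diagonal t)) * V := by
    rw [hP, hMt]
    have : (U * vecMulVec u u * V - U * diagonal t * V) * (U * vecMulVec u u * V + U * diagonal t * V)
      = U * ((vecMulVec u u - diagonal t) * (V * U) * (vecMulVec u u + diagonal t)) * V := by
      noncomm_ring
    rw [this, hVU, mul_one]
  rw [hK]
  generalize (vecMulVec u u - diagonal t) * (vecMulVec u u + diagonal t) = K at main ⊢
  have : U * K * V * (U * K * V) * (U * K * V) = U * (K * (V * U) * K * (V * U) * K) * V := by
    noncomm_ring
  rw [this, hVU, mul_one, mul_one, trace_mul_comm, ← mul_assoc, hVU, one_mul]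
  exact main

open Matrix in
lemma altC6_upper {n : ℕ} (hn : 0 < n) (G : SimpleGraph (Fin n)) :
    (numEmbAltC6 G : ℝ) ≤ (n : ℝ) ^ 6 / 64 := by
  have hn0 : (n : ℝ) ≠ 0 := by positivity
  set A : Matrix (Fin n) (Fin n) ℝ := Matrix.of fun i j => if G.Adj i j then 1 else 0 with hA
  set B : Matrix (Fin n) (Fin n) ℝ := Matrix.of fun i j => if G.Adj i j then 0 else 1 with hB
  have h1 : (numEmbAltC6 G : ℝ) ≤ ((B * A) * (B * A) * (B * A)).trace := by
    have hc : numEmbAltC6 G ≤ (Finset.univ.filter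
        (fun p : Fin n × Fin n × Fin n × Fin n × Fin n × Fin n =>
          (¬ G.Adj p.1 p.2.2.2.1 ∧ G.Adj p.2.2.2.1 p.2.1) ∧
          (¬ G.Adj p.2.1 p.2.2.2.2.1 ∧ G.Adj p.2.2.2.2.1 p.2.2.1) ∧
          (¬ G.Adj p.2.2.1 p.2.2.2.2.2 ∧ G.Adj p.2.2.2.2.2 p.1))).card := by
      unfold numEmbAltC6
      refine Finset.card_le_card_of_injOn (fun f => (f 0, f 2, f 4, f 1, f 3, f 5)) ?_ ?_
      · intro f hf
        simp only [Finset.coe_filter, Finset.mem_univ, true_and, Set.mem_ofPred_eq] at hf ⊢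
        obtain ⟨_, ho, he⟩ := hf
        exact ⟨⟨he 0 rfl, ho 1 rfl⟩, ⟨he 2 rfl, ho 3 rfl⟩, ⟨he 4 rfl, ho 5 rfl⟩⟩
      · intro f _ g _ h
        simp only [Prod.mk.injEq] at h
        funext i
        fin_cases i <;> simp_all
    refine (Nat.cast_le.2 hc).trans (le_of_eq ?_)
    rw [Finset.card_filter]
    push_cast
    simp only [Fintype.sum_prod_type]
    have h3 : ((B * A) * (B * A) * (B * A)).trace
        = ∑ a, ∑ c, ∑ e, (B * A) a c * (B * A) c e * (B * A) e a := by
      rw [trace]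
      refine Finset.sum_congr rfl fun a _ => ?_
      rw [diag_apply, mul_apply]
      simp only [mul_apply (M := B * A) (N := B * A), Finset.sum_mul]
      exact Finset.sum_comm
    rw [h3]
    refine Finset.sum_congr rfl fun a _ => Finset.sum_congr rfl fun c _ =>
      Finset.sum_congr rfl fun e _ => ?_
    simp only [mul_apply]
    rw [Finset.sum_mul_sum, Finset.sum_mul]
    refine Finset.sum_congr rfl fun b _ => ?_
    rw [Finset.sum_mul]
    refine Finset.sum_congr rfl fun d _ => ?_
    rw [Finset.mul_sum]
    refine Finset.sum_congr rfl fun f _ => ?_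
    simp only [hA, hB, of_apply]
    by_cases q1 : G.Adj a b <;> by_cases q2 : G.Adj b c <;> by_cases q3 : G.Adj c d <;>
      by_cases q4 : G.Adj d e <;> by_cases q5 : G.Adj e f <;> by_cases q6 : G.Adj f a <;>
      simp [q1, q2, q3, q4, q5, q6]
  refine h1.trans ?_
  set e : Fin n → ℝ := fun _ => 1 / Real.sqrt n with he
  have hee : (1 / Real.sqrt n) * (1 / Real.sqrt n) = 1 / (n : ℝ) := by
    rw [div_mul_div_comm, Real.mul_self_sqrt (Nat.cast_nonneg n), one_mul]
  set M : Matrix (Fin n) (Fin n) ℝ := (1 / (n : ℝ)) • (A - B) with hM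
  have hMs : M.IsHermitian := by
    ext i j
    simp [hM, hA, hB, G.adj_comm]
  have he1 : ∑ i, e i ^ 2 = 1 := by
    simp only [he, pow_two, hee]
    simp [hn0]
  have hM2 : (M * M).trace ≤ 1 := by
    have : ∀ i j, M i j * M j i = 1 / (n : ℝ) ^ 2 := by
      intro i j
      simp only [hM, hA, hB, Matrix.smul_apply, Matrix.sub_apply, of_apply, G.adj_comm j i, smul_eq_mul]
      split_ifs <;> ring
    simp only [trace, diag_apply, mul_apply, this]
    apply le_of_eq
    simp
    field_simp
  have main := altC6_matrix e M hMs he1 hM2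
  have hBe : B = ((n : ℝ) / 2) • (vecMulVec e e - M) := by
    ext i j
    simp only [hM, hA, hB, he, Matrix.smul_apply, Matrix.sub_apply, of_apply, vecMulVec_apply, smul_eq_mul, hee]
    split_ifs <;> field_simp <;> ring
  have hAe : A = ((n : ℝ) / 2) • (vecMulVec e e + M) := by
    ext i j
    simp only [hM, hA, hB, he, Matrix.smul_apply, Matrix.sub_apply, Matrix.add_apply, of_apply, vecMulVec_apply,
      smul_eq_mul, hee]
    split_ifs <;> field_simp <;> ring
  have : ((B * A) * (B * A) * (B * A)).trace = (n : ℝ) ^ 6 / 64 *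
      (((vecMulVec e e - M) * (vecMulVec e e + M)) *
      ((vecMulVec e e - M) * (vecMulVec e e + M)) *
      ((vecMulVec e e - M) * (vecMulVec e e + M))).trace := by
    clear_value M A B
    subst hBe hAe
    simp only [smul_mul_assoc, mul_smul_comm, smul_smul, trace_smul, smul_eq_mul]
    ring
  rw [this]
  calc _ ≤ (n : ℝ) ^ 6 / 64 * 1 := mul_le_mul_of_nonneg_left main (by positivity)
    _ = _ := mul_one _

/-- the pattern required of a graph on the image of the cycle -/
def altC6Good {n : ℕ} (f : Fin 6 → Fin n) (G : SimpleGraph (Fin n)) : Prop :=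
  ∀ i : Fin 6, G.Adj (f i) (f (i + 1)) ↔ i.val % 2 = 1

/-- graph made of some of the edges of the image of the 6-cycle -/
def altC6Part {n : ℕ} (f : Fin 6 → Fin n) (T : Finset (Fin 6)) : SimpleGraph (Fin n) :=
  SimpleGraph.fromEdgeSet {x | ∃ i ∈ T, x = s(f i, f (i + 1))}

lemma altC6Part_adj {n : ℕ} (f : Fin 6 → Fin n) (hf : Function.Injective f) (T : Finset (Fin 6))
    (i : Fin 6) : (altC6Part f T).Adj (f i) (f (i + 1)) ↔ i ∈ T := by
  have hd : ∀ i j : Fin 6, (i = j ∧ i + 1 = j + 1 ∨ i = j + 1 ∧ i + 1 = j) → i = j := by decide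
  have hne : ∀ i : Fin 6, i ≠ i + 1 := by decide
  simp only [altC6Part, SimpleGraph.fromEdgeSet_adj, Set.mem_ofPred_eq, Sym2.eq_iff, hf.eq_iff,
    ne_eq, hne i, not_false_eq_true, and_true]
  constructor
  · rintro ⟨j, hj, h⟩
    rw [hd i j h]; exact hj
  · intro h
    exact ⟨i, h, Or.inl ⟨rfl, rfl⟩⟩

lemma altC6_symmDiff_adj {n : ℕ} (G H : SimpleGraph (Fin n)) (a b : Fin n) :
    (symmDiff G H).Adj a b ↔ ¬ (G.Adj a b ↔ H.Adj a b) := by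
  simp only [symmDiff, SimpleGraph.sup_adj, SimpleGraph.sdiff_adj]
  tauto

lemma altC6_count {n : ℕ} (f : Fin 6 → Fin n) (hf : Function.Injective f) :
    Fintype.card (SimpleGraph (Fin n)) ≤
      64 * (Finset.univ.filter (fun G : SimpleGraph (Fin n) => altC6Good f G)).card := by
  let bad : SimpleGraph (Fin n) → Finset (Fin 6) := fun G =>
    Finset.univ.filter fun i => ¬ (G.Adj (f i) (f (i + 1)) ↔ i.val % 2 = 1)
  have h64 : (Finset.univ : Finset (Finset (Fin 6))).card = 64 := by
    rw [Finset.card_univ, Fintype.card_finset, Fintype.card_fin]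
    norm_num
  rw [← h64, ← Finset.card_product, ← Finset.card_univ]
  refine Finset.card_le_card_of_injOn (fun G => (bad G, symmDiff G (altC6Part f (bad G)))) ?_ ?_
  · intro G _
    simp only [Finset.coe_product, Set.mem_prod, Finset.coe_univ, Set.mem_univ, true_and,
      Finset.coe_filter, Finset.mem_univ, Set.mem_ofPred_eq]
    intro i
    rw [altC6_symmDiff_adj, altC6Part_adj f hf]
    simp only [bad, Finset.mem_filter, Finset.mem_univ, true_and]
    tauto
  · intro G _ G' _ h
    simp only [Prod.mk.injEq] at h
    obtain ⟨h1, h2⟩ := h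
    rw [h1] at h2
    exact symmDiff_left_injective _ h2

lemma altC6_numEmb_eq {n : ℕ} (G : SimpleGraph (Fin n)) :
    numEmbAltC6 G = ((Finset.univ.filter (fun f : Fin 6 → Fin n => Function.Injective f)).filter
      (fun f => altC6Good f G)).card := by
  unfold numEmbAltC6
  rw [Finset.filter_filter]
  congr 1
  ext f
  rw [Finset.mem_filter, Finset.mem_filter]
  simp only [Finset.mem_univ, true_and, altC6Good]
  refine and_congr_right fun _ => ⟨?_, ?_⟩
  · rintro ⟨ho, he⟩ i
    rcases Nat.mod_two_eq_zero_or_one i.val with h | h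
    · have := he i h
      simp [this, h]
    · simp [ho i h, h]
  · intro h
    exact ⟨fun i hi => (h i).2 hi, fun i hi hG => by have := (h i).1 hG; omega⟩

lemma altC6_inj_card (n : ℕ) :
    (Finset.univ.filter (fun f : Fin 6 → Fin n => Function.Injective f)).card
      = n.descFactorial 6 := by
  rw [← Fintype.card_subtype, Fintype.card_congr (Equiv.subtypeInjectiveEquivEmbedding _ _),
    Fintype.card_embedding_eq, Fintype.card_fin, Fintype.card_fin]

lemma altC6_lower (n : ℕ) :
    ∃ G : SimpleGraph (Fin n), n.descFactorial 6 ≤ 64 * numEmbAltC6 G := by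
  by_contra! hcon
  have h1 : ∑ G : SimpleGraph (Fin n), 64 * numEmbAltC6 G
      < ∑ _G : SimpleGraph (Fin n), n.descFactorial 6 :=
    Finset.sum_lt_sum_of_nonempty ⟨⊥, Finset.mem_univ _⟩ fun G _ => hcon G
  have h2 : ∑ _G : SimpleGraph (Fin n), n.descFactorial 6
      ≤ ∑ G : SimpleGraph (Fin n), 64 * numEmbAltC6 G := by
    rw [← Finset.mul_sum]
    simp only [altC6_numEmb_eq]
    have := Finset.sum_card_bipartiteAbove_eq_sum_card_bipartiteBelow
      (s := (Finset.univ : Finset (SimpleGraph (Fin n))))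
      (t := Finset.univ.filter (fun f : Fin 6 → Fin n => Function.Injective f))
      (fun G f => altC6Good f G)
    simp only [Finset.bipartiteAbove, Finset.bipartiteBelow] at this
    rw [this, Finset.mul_sum, Finset.sum_const, Finset.card_univ, smul_eq_mul, mul_comm,
      ← altC6_inj_card n, ← smul_eq_mul, ← Finset.sum_const]
    refine Finset.sum_le_sum fun f hf => ?_
    exact altC6_count f (Finset.mem_filter.1 hf).2
  omega

lemma altC6_ratio : Filter.Tendsto (fun n : ℕ => (n : ℝ) ^ 6 / 64 / (n.descFactorial 6 : ℝ))
    Filter.atTop (nhds (1 / 64)) := by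
  have h1 : Filter.Tendsto (fun n : ℕ => (1 / 64 : ℝ) * ((1 - 1 * (n : ℝ)⁻¹) * (1 - 2 * (n : ℝ)⁻¹)
      * (1 - 3 * (n : ℝ)⁻¹) * (1 - 4 * (n : ℝ)⁻¹) * (1 - 5 * (n : ℝ)⁻¹))⁻¹)
      Filter.atTop (nhds (1 / 64)) := by
    have hi : Filter.Tendsto (fun n : ℕ => (n : ℝ)⁻¹) Filter.atTop (nhds 0) :=
      tendsto_inv_atTop_nhds_zero_nat
    have hc : ∀ c : ℝ, Filter.Tendsto (fun n : ℕ => 1 - c * (n : ℝ)⁻¹) Filter.atTop (nhds 1) := by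
      intro c
      simpa using (hi.const_mul c).const_sub 1
    have := ((((hc 1).mul (hc 2)).mul (hc 3)).mul (hc 4)).mul (hc 5)
    have := (this.inv₀ (by norm_num)).const_mul (1 / 64 : ℝ)
    simpa using this
  refine h1.congr' ?_
  filter_upwards [Filter.eventually_ge_atTop 6] with n hn
  obtain ⟨k, rfl⟩ := Nat.exists_eq_add_of_le hn
  have hdf : ((6 + k).descFactorial 6 : ℝ)
      = (6 + k) * (5 + k) * (4 + k) * (3 + k) * (2 + k) * (1 + k) := by
    have : (6 + k).descFactorial 6 = (6 + k) * (5 + k) * (4 + k) * (3 + k) * (2 + k) * (1 + k) := by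
      simp only [Nat.descFactorial_succ, Nat.descFactorial_zero]
      rw [show 6 + k - 5 = 1 + k by omega, show 6 + k - 4 = 2 + k by omega,
        show 6 + k - 3 = 3 + k by omega, show 6 + k - 2 = 4 + k by omega,
        show 6 + k - 1 = 5 + k by omega, show 6 + k - 0 = 6 + k by omega]
      ring
    rw [this]; push_cast; ring
  rw [hdf]
  push_cast
  have h6 : (6 + k : ℝ) ≠ 0 := by positivity
  have e1 : 1 - 1 * (6 + k : ℝ)⁻¹ = (5 + k) / (6 + k) := by field_simp; ring
  have e2 : 1 - 2 * (6 + k : ℝ)⁻¹ = (4 + k) / (6 + k) := by field_simp; ring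
  have e3 : 1 - 3 * (6 + k : ℝ)⁻¹ = (3 + k) / (6 + k) := by field_simp; ring
  have e4 : 1 - 4 * (6 + k : ℝ)⁻¹ = (2 + k) / (6 + k) := by field_simp; ring
  have e5 : 1 - 5 * (6 + k : ℝ)⁻¹ = (1 + k) / (6 + k) := by field_simp; ring
  rw [e1, e2, e3, e4, e5]
  field_simp

end AltC6

theorem semi_inducibility_alternating_six_cycle :
    Filter.Tendsto (fun n => lamAltC6max n) Filter.atTop (nhds (1/64)) := by
  refine tendsto_of_tendsto_of_tendsto_of_le_of_le' tendsto_const_nhds altC6_ratio ?_ ?_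
  · filter_upwards [Filter.eventually_ge_atTop 6] with n hn
    obtain ⟨G, hG⟩ := altC6_lower n
    have hpos : (0 : ℝ) < (n.descFactorial 6 : ℝ) := by
      exact_mod_cast Nat.descFactorial_pos.2 hn
    have h1 : (1 / 64 : ℝ) ≤ lamAltC6 G := by
      unfold lamAltC6
      rw [le_div_iff₀ hpos]
      have : (n.descFactorial 6 : ℝ) ≤ 64 * (numEmbAltC6 G : ℝ) := by exact_mod_cast hG
      linarith
    exact h1.trans (le_ciSup (f := fun G : SimpleGraph (Fin n) => lamAltC6 G)
      (Set.finite_range _).bddAbove G)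
  · filter_upwards [Filter.eventually_ge_atTop 6] with n hn
    refine ciSup_le fun G => ?_
    unfold lamAltC6
    exact div_le_div_of_nonneg_right (altC6_upper (by omega) G) (Nat.cast_nonneg _)
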